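/- Let {h_i}_{i∈I} generate a parabolic Cantor set, fix i_0 ∈ I with sup_{x∈[0,1]} |h_{i_0}'(x)| < 1, and let I_∞ := {j i_0 : j ∈ (I∖{i_0})^*} ∪ {i_0}. If ∑_{i∈I_∞} |h_i([0,1])|^{α_h} < ∞ (where |h_i([0,1])| is the diameter of h_i([0,1])), then there exists a constant 1 < C < ∞ such that for every finite concatenation i of words from I_∞ and all x, y ∈ [0,1], |h_i'(x)| ≤ C |h_i'(y)|. -/

import Mathlib

open Set Filter MeasureTheory Metric Topology
open scoped ENNReal NNReal

/-- Composition of the maps along a finite word: `h_{i₁…iₙ} = h_{i₁} ∘ ⋯ ∘ h_{iₙ}`. -/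
def wMap {I : Type} (h : I → ℝ → ℝ) : List I → ℝ → ℝ
  | [] => id
  | a :: t => h a ∘ wMap h t

/-- Derivative cocycle of the composition along a finite word (chain rule). -/
def wDeriv {I : Type} (h h' : I → ℝ → ℝ) : List I → ℝ → ℝ
  | [] => fun _ => 1
  | a :: t => fun x => h' a (wMap h t x) * wDeriv h h' t x

/-- `‖h_w'‖_∞`, the sup of `|h_w'|` over `[0,1]`. -/
noncomputable def supD {I : Type} (h h' : I → ℝ → ℝ) (w : List I) : ℝ :=
  ⨆ x : Icc (0:ℝ) 1, |wDeriv h h' w x|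

/-- The cylinder of infinite words beginning with the finite word `w`. -/
def cyl {I : Type} (w : List I) : Set (ℕ → I) := {ω | ∀ k : Fin w.length, ω k = w.get k}

/-- A parabolic IFS on `[0,1]` satisfying A1', A2', A3' (parabolic Cantor set system). -/
structure PCantorIFS (I : Type) [Fintype I] where
  h : I → ℝ → ℝ
  h' : I → ℝ → ℝ
  αh : ℝ
  αh_pos : 0 < αh
  card : 2 ≤ Fintype.card I
  maps : ∀ i, MapsTo (h i) (Icc (0:ℝ) 1) (Icc (0:ℝ) 1)
  contract : ∀ i, ∀ x ∈ Icc (0:ℝ) 1, ∀ y ∈ Icc (0:ℝ) 1, x ≠ y → |h i x - h i y| < |x - y|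
  hasDeriv : ∀ i, ∀ x ∈ Icc (0:ℝ) 1, HasDerivWithinAt (h i) (h' i x) (Icc (0:ℝ) 1) x
  holder : ∃ C > 0, ∀ i, ∀ x ∈ Icc (0:ℝ) 1, ∀ y ∈ Icc (0:ℝ) 1,
      |h' i x - h' i y| ≤ C * |x - y| ^ αh
  nonzero : ∀ i, ∀ x ∈ Icc (0:ℝ) 1, h' i x ≠ 0
  sep : ∀ i j, i ≠ j → Disjoint (h i '' Ioo (0:ℝ) 1) (h j '' Ioo (0:ℝ) 1)

/-- The induced (hyperbolic) alphabet `I_∞ = {j i₀ : j ∈ (I ∖ {i₀})^*} ∪ {i₀}`. -/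
def Iinf {I : Type} (i0 : I) : Set (List I) :=
  {w | ∃ j : List I, (∀ a ∈ j, a ≠ i0) ∧ w = j ++ [i0]}

/-- Finite concatenations of words from `I_∞`. -/
def IinfStar {I : Type} (i0 : I) : Set (List I) :=
  {w | ∃ L : List (List I), (∀ u ∈ L, u ∈ Iinf i0) ∧ w = L.flatten}

/-- The truncated induced alphabet `I_N`. -/
def IN {I : Type} (i0 : I) (N : ℕ) : Set (List I) :=
  {w | w ∈ Iinf i0 ∧ w.length ≤ N}

/-- The weak quasi-Bernoulli property. -/
def WeakQB {I : Type} [MeasurableSpace I] (P : Measure (ℕ → I)) : Prop :=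
  ∃ c : ℕ → ℝ, (∀ n, 0 < c n) ∧
    Tendsto (fun n : ℕ => c n ^ ((n : ℝ)⁻¹)) atTop (𝓝 1) ∧
    ∀ L : List (List I), (∀ w ∈ L, w ≠ []) →
      ((L.map fun w => c w.length).prod)⁻¹ * (L.map fun w => (P (cyl w)).toReal).prod
          ≤ (P (cyl L.flatten)).toReal ∧
        (P (cyl L.flatten)).toReal
          ≤ (L.map fun w => c w.length).prod * (L.map fun w => (P (cyl w)).toReal).prod

/-- The quasi-Bernoulli property restricted to concatenations of words from `I_∞`. -/
def QBonInf {I : Type} [MeasurableSpace I] (P : Measure (ℕ → I)) (i0 : I) : Prop :=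
  ∃ c : ℝ, 1 ≤ c ∧ ∀ u ∈ IinfStar i0, ∀ v ∈ IinfStar i0,
    c⁻¹ * ((P (cyl u)).toReal * (P (cyl v)).toReal) ≤ (P (cyl (u ++ v))).toReal ∧
    (P (cyl (u ++ v))).toReal ≤ c * ((P (cyl u)).toReal * (P (cyl v)).toReal)

/-- The partition sums `∑_{i ∈ I^n} ℙ([i])^q ‖h_i'‖_∞^s` over the full alphabet. -/
noncomputable def pSum {I : Type} [Fintype I] [MeasurableSpace I]
    (P : Measure (ℕ → I)) (h h' : I → ℝ → ℝ) (n : ℕ) (s q : ℝ) : ℝ :=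
  ∑ w : Fin n → I, (P (cyl (List.ofFn w))).toReal ^ q * supD h h' (List.ofFn w) ^ s

/-- The partition sums over `n`-fold concatenations of words from an alphabet `J` of
finite words. -/
noncomputable def zSum {I : Type} [MeasurableSpace I]
    (P : Measure (ℕ → I)) (h h' : I → ℝ → ℝ) (J : Set (List I)) (n : ℕ) (s q : ℝ) : ℝ :=
  ∑' w : Fin n → ↥J,
    (P (cyl (List.flatten (List.ofFn fun k => ((w k : List I)))))).toReal ^ q *
      supD h h' (List.flatten (List.ofFn fun k => ((w k : List I)))) ^ s

/-- `x ^ q` with the convention `0^0 = 0` used for moment sums. -/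
noncomputable def pw (a q : ℝ) : ℝ := if a = 0 then 0 else a ^ q

/-- The `q`-th moment sum of a measure on `ℝ` over the closed intervals of the `δ`-mesh. -/
noncomputable def Dq1 (ν : Measure ℝ) (q δ : ℝ) : ℝ :=
  ∑' k : ℤ, pw ((ν (Icc ((k : ℝ) * δ) (((k : ℝ) + 1) * δ))).toReal) q

/-- Number of intervals of the `δ`-mesh which intersect `F ⊆ ℝ`. -/
noncomputable def covCount (F : Set ℝ) (δ : ℝ) : ℕ :=
  Set.ncard {k : ℤ | (Icc ((k : ℝ) * δ) (((k : ℝ) + 1) * δ) ∩ F).Nonempty}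

theorem wMap_append {I : Type} (h : I → ℝ → ℝ) (u v : List I) (x : ℝ) :
    wMap h (u ++ v) x = wMap h u (wMap h v x) := by
  induction u with
  | nil => rfl
  | cons a t ih => exact congrArg (h a) ih

theorem drop_append_mem_Iinf {I : Type} {i0 : I} {j : List I} (hj : ∀ a ∈ j, a ≠ i0) (k : ℕ) :
    j.drop k ++ [i0] ∈ Iinf i0 :=
  ⟨j.drop k, fun a ha => hj a (List.mem_of_mem_drop ha), rfl⟩

theorem sum_drop_le_tsum_Iinf {I : Type} {i0 : I} {f : List I → ℝ} (hf0 : ∀ w, 0 ≤ f w)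
    (hf : Summable fun w : ↥(Iinf i0) => f w) {j : List I} (hj : ∀ a ∈ j, a ≠ i0) :
    ∑ k ∈ Finset.range j.length, f (j.drop (k + 1) ++ [i0]) ≤ ∑' w : ↥(Iinf i0), f w := by
  let e : Fin j.length → ↥(Iinf i0) := fun k => ⟨_, drop_append_mem_Iinf hj (k + 1)⟩
  have he : Function.Injective e := fun k l hkl => by
    have := congrArg (fun w : ↥(Iinf i0) => (w : List I).length) hkl
    simp only [e, List.length_append, List.length_drop, List.length_singleton] at this
    ext
    omega
  rw [← Fin.sum_univ_eq_sum_range (fun k => f (j.drop (k + 1) ++ [i0])),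
    ← tsum_fintype (L := .unconditional _)]
  exact tsum_comp_le_tsum_of_inj hf (fun w => hf0 w) he

namespace PCantorIFS

variable {I : Type} [Fintype I] (S : PCantorIFS I)

theorem continuousOn_deriv (i : I) : ContinuousOn (S.h' i) (Icc (0:ℝ) 1) := by
  obtain ⟨C, -, hC⟩ := S.holder
  intro x hx
  rw [ContinuousWithinAt, tendsto_iff_dist_tendsto_zero]
  have hlim : Tendsto (fun y : ℝ => C * |y - x| ^ S.αh) (𝓝[Icc (0:ℝ) 1] x) (𝓝 0) := by
    have hc : Continuous fun y : ℝ => C * |y - x| ^ S.αh :=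
      continuous_const.mul ((by fun_prop : Continuous fun y : ℝ => |y - x|).rpow_const
        fun _ => Or.inr S.αh_pos.le)
    have := (hc.tendsto x).mono_left (nhdsWithin_le_nhds (s := Icc (0:ℝ) 1))
    simpa [Real.zero_rpow S.αh_pos.ne'] using this
  refine squeeze_zero' (Eventually.of_forall fun _ => dist_nonneg) ?_ hlim
  filter_upwards [self_mem_nhdsWithin] with y hy
  exact hC i y hy x hx

/-- A single-letter distortion estimate, uniform over the alphabet. -/
theorem exists_letter_distortion :
    ∃ K : ℝ, 0 ≤ K ∧ ∀ i, ∀ x ∈ Icc (0:ℝ) 1, ∀ y ∈ Icc (0:ℝ) 1,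
      |S.h' i x| ≤ Real.exp (K * |x - y| ^ S.αh) * |S.h' i y| := by
  obtain ⟨C, hC0, hC⟩ := S.holder
  have hmin : ∀ i, ∃ m : ℝ, 0 < m ∧ ∀ x ∈ Icc (0:ℝ) 1, m ≤ |S.h' i x| := fun i => by
    obtain ⟨z, hz, hzmin⟩ := isCompact_Icc.exists_isMinOn (nonempty_Icc.2 zero_le_one)
      (S.continuousOn_deriv i).abs
    exact ⟨_, abs_pos.2 (S.nonzero i z hz), fun x hx => hzmin hx⟩
  choose m hm0 hm using hmin
  have hterm : ∀ i ∈ Finset.univ, 0 ≤ C / m i := fun i _ => (div_pos hC0 (hm0 i)).le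
  refine ⟨∑ i, C / m i, Finset.sum_nonneg hterm, fun i x hx y hy => ?_⟩
  have hK : C / m i ≤ ∑ i, C / m i := Finset.single_le_sum hterm (Finset.mem_univ i)
  have hd : 0 ≤ |x - y| ^ S.αh := by positivity
  have hCK : C ≤ (∑ i, C / m i) * |S.h' i y| :=
    calc C = C / m i * m i := (div_mul_cancel₀ _ (hm0 i).ne').symm
      _ ≤ _ := mul_le_mul hK (hm i y hy) (hm0 i).le (Finset.sum_nonneg hterm)
  calc |S.h' i x| ≤ |S.h' i x - S.h' i y| + |S.h' i y| := by
        simpa using abs_add_le (S.h' i x - S.h' i y) (S.h' i y)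
    _ ≤ C * |x - y| ^ S.αh + |S.h' i y| := by gcongr; exact hC i x hx y hy
    _ ≤ (∑ i, C / m i) * |S.h' i y| * |x - y| ^ S.αh + |S.h' i y| := by gcongr
    _ = ((∑ i, C / m i) * |x - y| ^ S.αh + 1) * |S.h' i y| := by ring
    _ ≤ _ := by gcongr; exact Real.add_one_le_exp _

theorem mapsTo_wMap (w : List I) : MapsTo (wMap S.h w) (Icc (0:ℝ) 1) (Icc (0:ℝ) 1) := by
  induction w with
  | nil => exact mapsTo_id _
  | cons a t ih => exact (S.maps a).comp ih

theorem hasDerivWithinAt_wMap (w : List I) {x : ℝ} (hx : x ∈ Icc (0:ℝ) 1) :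
    HasDerivWithinAt (wMap S.h w) (wDeriv S.h S.h' w x) (Icc (0:ℝ) 1) x := by
  induction w with
  | nil => exact hasDerivWithinAt_id _ _
  | cons a t ih => exact (S.hasDeriv a _ (S.mapsTo_wMap t hx)).comp x ih (S.mapsTo_wMap t)

theorem abs_h_sub_le (i : I) {x y : ℝ} (hx : x ∈ Icc (0:ℝ) 1) (hy : y ∈ Icc (0:ℝ) 1) :
    |S.h i x - S.h i y| ≤ |x - y| := by
  rcases eq_or_ne x y with rfl | hne
  · simp
  · exact (S.contract i x hx y hy hne).le

theorem abs_wMap_sub_le (w : List I) {x y : ℝ} (hx : x ∈ Icc (0:ℝ) 1) (hy : y ∈ Icc (0:ℝ) 1) :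
    |wMap S.h w x - wMap S.h w y| ≤ |x - y| := by
  induction w with
  | nil => exact le_rfl
  | cons a t ih => exact (S.abs_h_sub_le a (S.mapsTo_wMap t hx) (S.mapsTo_wMap t hy)).trans ih

theorem abs_wMap_sub_le_diam (w : List I) {x y : ℝ} (hx : x ∈ Icc (0:ℝ) 1)
    (hy : y ∈ Icc (0:ℝ) 1) :
    |wMap S.h w x - wMap S.h w y| ≤ diam (wMap S.h w '' Icc (0:ℝ) 1) :=
  dist_le_diam_of_mem (isBounded_Icc (0:ℝ) 1 |>.subset (S.mapsTo_wMap w).image_subset)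
    (mem_image_of_mem _ hx) (mem_image_of_mem _ hy)

/-- The sum of `|h_t x - h_t y| ^ α` over the proper suffixes `t` of a word. -/
noncomputable def suffixSum : List I → ℝ → ℝ → ℝ
  | [], _, _ => 0
  | _ :: t, x, y => |wMap S.h t x - wMap S.h t y| ^ S.αh + suffixSum t x y

theorem abs_wDeriv_le_exp_suffixSum {K : ℝ}
    (hK : ∀ i, ∀ x ∈ Icc (0:ℝ) 1, ∀ y ∈ Icc (0:ℝ) 1,
      |S.h' i x| ≤ Real.exp (K * |x - y| ^ S.αh) * |S.h' i y|)
    (w : List I) {x y : ℝ} (hx : x ∈ Icc (0:ℝ) 1) (hy : y ∈ Icc (0:ℝ) 1) :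
    |wDeriv S.h S.h' w x| ≤ Real.exp (K * S.suffixSum w x y) * |wDeriv S.h S.h' w y| := by
  induction w with
  | nil => simp [wDeriv, suffixSum]
  | cons a t ih =>
    simp only [wDeriv, suffixSum, abs_mul, mul_add, Real.exp_add]
    calc _ ≤ _ := mul_le_mul (hK a _ (S.mapsTo_wMap t hx) _ (S.mapsTo_wMap t hy)) ih
          (abs_nonneg _) (by positivity)
      _ = _ := by ring

theorem suffixSum_append (u v : List I) (x y : ℝ) :
    S.suffixSum (u ++ v) x y =
      S.suffixSum u (wMap S.h v x) (wMap S.h v y) + S.suffixSum v x y := by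
  induction u with
  | nil => simp [suffixSum]
  | cons a t ih => simp [suffixSum, ih, wMap_append, add_assoc]

theorem suffixSum_append_singleton (j : List I) (i : I) (x y : ℝ) :
    S.suffixSum (j ++ [i]) x y = |x - y| ^ S.αh +
      ∑ k ∈ Finset.range j.length, |wMap S.h (j.drop (k + 1) ++ [i]) x -
        wMap S.h (j.drop (k + 1) ++ [i]) y| ^ S.αh := by
  induction j with
  | nil => simp [suffixSum, wMap]
  | cons a t ih =>
    rw [List.cons_append, suffixSum, ih, List.length_cons, Finset.sum_range_succ']
    simp only [List.drop_succ_cons, List.drop_zero]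
    ring

theorem abs_h_sub_le_supD (i : I) {x y : ℝ} (hx : x ∈ Icc (0:ℝ) 1) (hy : y ∈ Icc (0:ℝ) 1) :
    |S.h i x - S.h i y| ≤ supD S.h S.h' [i] * |x - y| := by
  have hb : BddAbove (range fun z : Icc (0:ℝ) 1 => |wDeriv S.h S.h' [i] z|) := by
    obtain ⟨B, hB⟩ := isCompact_Icc.bddAbove_image (S.continuousOn_deriv i).abs
    refine ⟨B, ?_⟩
    rintro _ ⟨z, rfl⟩
    simpa [wDeriv, wMap] using hB (mem_image_of_mem _ z.2)
  refine (convex_Icc (0:ℝ) 1).norm_image_sub_le_of_norm_hasDerivWithin_le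
    (S.hasDeriv i) (fun z hz => ?_) hy hx
  simpa [supD, wDeriv, wMap] using le_ciSup hb ⟨z, hz⟩

theorem supD_nonneg (w : List I) : 0 ≤ supD S.h S.h' w :=
  Real.iSup_nonneg fun _ => abs_nonneg _

theorem abs_wMap_flatten_sub_le {i0 : I} (L : List (List I)) (hL : ∀ u ∈ L, u ∈ Iinf i0)
    {x y : ℝ} (hx : x ∈ Icc (0:ℝ) 1) (hy : y ∈ Icc (0:ℝ) 1) :
    |wMap S.h L.flatten x - wMap S.h L.flatten y| ≤
      supD S.h S.h' [i0] ^ L.length * |x - y| := by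
  induction L with
  | nil => simp [wMap]
  | cons u L ih =>
    obtain ⟨j, -, rfl⟩ := hL _ List.mem_cons_self
    have ih := ih fun v hv => hL v (List.mem_cons_of_mem _ hv)
    have hx' := S.mapsTo_wMap L.flatten hx
    have hy' := S.mapsTo_wMap L.flatten hy
    simp only [List.flatten_cons, wMap_append, List.length_cons, pow_succ']
    calc _ ≤ _ := S.abs_wMap_sub_le j (S.mapsTo_wMap [i0] hx') (S.mapsTo_wMap [i0] hy')
      _ ≤ _ := S.abs_h_sub_le_supD i0 hx' hy'
      _ ≤ _ := mul_le_mul_of_nonneg_left ih (S.supD_nonneg _)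
      _ = _ := by ring

/-- Bounded distortion makes a word contract every interval in proportion to its image. -/
theorem abs_wMap_sub_le_mul_diam {w : List I} {C : ℝ} (hC0 : 0 ≤ C)
    (hC : ∀ x ∈ Icc (0:ℝ) 1, ∀ y ∈ Icc (0:ℝ) 1,
      |wDeriv S.h S.h' w x| ≤ C * |wDeriv S.h S.h' w y|)
    {x y : ℝ} (hx : x ∈ Icc (0:ℝ) 1) (hy : y ∈ Icc (0:ℝ) 1) :
    |wMap S.h w x - wMap S.h w y| ≤ C * diam (wMap S.h w '' Icc (0:ℝ) 1) * |x - y| := by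
  obtain ⟨z, hz, hzslope⟩ := exists_hasDerivAt_eq_slope (wMap S.h w) (wDeriv S.h S.h' w)
    zero_lt_one (fun z hz => (S.hasDerivWithinAt_wMap w hz).continuousWithinAt)
    (fun z hz => (S.hasDerivWithinAt_wMap w (Ioo_subset_Icc_self hz)).hasDerivAt
      (Icc_mem_nhds hz.1 hz.2))
  have hzdiam : |wDeriv S.h S.h' w z| ≤ diam (wMap S.h w '' Icc (0:ℝ) 1) := by
    rw [hzslope, sub_zero, div_one]
    exact S.abs_wMap_sub_le_diam w (right_mem_Icc.2 zero_le_one) (left_mem_Icc.2 zero_le_one)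
  exact (convex_Icc (0:ℝ) 1).norm_image_sub_le_of_norm_hasDerivWithin_le
    (fun z hz => S.hasDerivWithinAt_wMap w hz)
    (fun v hv => (hC v hv z (Ioo_subset_Icc_self hz)).trans
      (mul_le_mul_of_nonneg_left hzdiam hC0)) hy hx

theorem abs_sub_rpow_le_one {x y : ℝ} (hx : x ∈ Icc (0:ℝ) 1) (hy : y ∈ Icc (0:ℝ) 1) :
    |x - y| ^ S.αh ≤ 1 :=
  Real.rpow_le_one (abs_nonneg _)
    (abs_le.2 ⟨by linarith [hx.1, hy.2], by linarith [hx.2, hy.1]⟩) S.αh_pos.le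

theorem exists_distortion_Iinf {i0 : I}
    (hsum : Summable fun w : ↥(Iinf i0) =>
      diam (wMap S.h (w : List I) '' Icc (0:ℝ) 1) ^ S.αh) :
    ∃ C : ℝ, 0 ≤ C ∧ ∀ w ∈ Iinf i0, ∀ x ∈ Icc (0:ℝ) 1, ∀ y ∈ Icc (0:ℝ) 1,
      |wDeriv S.h S.h' w x| ≤ C * |wDeriv S.h S.h' w y| := by
  obtain ⟨K, hK0, hK⟩ := S.exists_letter_distortion
  have hnn : ∀ w : List I, 0 ≤ diam (wMap S.h w '' Icc (0:ℝ) 1) ^ S.αh :=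
    fun w => Real.rpow_nonneg diam_nonneg S.αh
  refine ⟨Real.exp (K * (1 + ∑' w : ↥(Iinf i0),
    diam (wMap S.h (w : List I) '' Icc (0:ℝ) 1) ^ S.αh)), (Real.exp_pos _).le, ?_⟩
  rintro _ ⟨j, hj, rfl⟩ x hx y hy
  refine (S.abs_wDeriv_le_exp_suffixSum hK _ hx hy).trans ?_
  refine mul_le_mul_of_nonneg_right (Real.exp_le_exp.2 (mul_le_mul_of_nonneg_left ?_ hK0))
    (abs_nonneg _)
  rw [suffixSum_append_singleton]
  refine add_le_add (S.abs_sub_rpow_le_one hx hy) (le_trans (Finset.sum_le_sum fun k _ => ?_)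
    (sum_drop_le_tsum_Iinf hnn hsum hj))
  exact Real.rpow_le_rpow (abs_nonneg _) (S.abs_wMap_sub_le_diam _ hx hy) S.αh_pos.le

theorem exists_suffixSum_le_of_mem_Iinf {i0 : I}
    (hsum : Summable fun w : ↥(Iinf i0) =>
      diam (wMap S.h (w : List I) '' Icc (0:ℝ) 1) ^ S.αh) :
    ∃ B : ℝ, 0 ≤ B ∧ ∀ w ∈ Iinf i0, ∀ x ∈ Icc (0:ℝ) 1, ∀ y ∈ Icc (0:ℝ) 1,
      S.suffixSum w x y ≤ B * |x - y| ^ S.αh := by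
  obtain ⟨C, hC0, hC⟩ := S.exists_distortion_Iinf hsum
  have hnn : ∀ w : List I, 0 ≤ diam (wMap S.h w '' Icc (0:ℝ) 1) ^ S.αh :=
    fun w => Real.rpow_nonneg diam_nonneg S.αh
  refine ⟨1 + C ^ S.αh * ∑' w : ↥(Iinf i0),
    diam (wMap S.h (w : List I) '' Icc (0:ℝ) 1) ^ S.αh,
    add_nonneg zero_le_one (mul_nonneg (Real.rpow_nonneg hC0 _) (tsum_nonneg fun w => hnn w)),
    ?_⟩
  rintro _ ⟨j, hj, rfl⟩ x hx y hy
  rw [suffixSum_append_singleton, add_mul, one_mul]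
  gcongr
  refine le_trans ?_ (mul_le_mul_of_nonneg_right (mul_le_mul_of_nonneg_left
    (sum_drop_le_tsum_Iinf hnn hsum hj) (Real.rpow_nonneg hC0 _)) (by positivity))
  rw [Finset.mul_sum, Finset.sum_mul]
  refine Finset.sum_le_sum fun k _ => ?_
  rw [← Real.mul_rpow hC0 diam_nonneg,
    ← Real.mul_rpow (mul_nonneg hC0 diam_nonneg) (abs_nonneg _)]
  exact Real.rpow_le_rpow (abs_nonneg _) (S.abs_wMap_sub_le_mul_diam hC0
    (hC _ (drop_append_mem_Iinf hj _)) hx hy) S.αh_pos.le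

theorem suffixSum_flatten_le {i0 : I} {B : ℝ} (hB0 : 0 ≤ B)
    (hB : ∀ w ∈ Iinf i0, ∀ x ∈ Icc (0:ℝ) 1, ∀ y ∈ Icc (0:ℝ) 1,
      S.suffixSum w x y ≤ B * |x - y| ^ S.αh)
    (L : List (List I)) (hL : ∀ u ∈ L, u ∈ Iinf i0)
    {x y : ℝ} (hx : x ∈ Icc (0:ℝ) 1) (hy : y ∈ Icc (0:ℝ) 1) :
    S.suffixSum L.flatten x y ≤
      B * ∑ k ∈ Finset.range L.length, (supD S.h S.h' [i0] ^ S.αh) ^ k := by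
  induction L with
  | nil => simp [suffixSum]
  | cons u L ih =>
    have hL' : ∀ v ∈ L, v ∈ Iinf i0 := fun v hv => hL v (List.mem_cons_of_mem _ hv)
    have hρ := S.supD_nonneg [i0]
    rw [List.flatten_cons, suffixSum_append, List.length_cons, Finset.sum_range_succ, mul_add,
      add_comm]
    refine add_le_add (ih hL') ((hB u (hL u List.mem_cons_self) _ (S.mapsTo_wMap _ hx) _
      (S.mapsTo_wMap _ hy)).trans (mul_le_mul_of_nonneg_left ?_ hB0))
    calc _ ≤ (supD S.h S.h' [i0] ^ L.length * |x - y|) ^ S.αh :=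
          Real.rpow_le_rpow (abs_nonneg _) (S.abs_wMap_flatten_sub_le L hL' hx hy) S.αh_pos.le
      _ = (supD S.h S.h' [i0] ^ S.αh) ^ L.length * |x - y| ^ S.αh := by
          rw [Real.mul_rpow (by positivity) (abs_nonneg _), Real.rpow_pow_comm hρ]
      _ ≤ _ := mul_le_of_le_one_right (by positivity) (S.abs_sub_rpow_le_one hx hy)

end PCantorIFS

/-- Bounded distortion on the induced hyperbolic system: if
`∑_{i ∈ I_∞} |h_i([0,1])|^{α_h} < ∞` then there is `1 < C < ∞` with
`|h_i'(x)| ≤ C |h_i'(y)|` for every finite concatenation `i` of words from `I_∞`. -/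
theorem bounded_distortion_induced {I : Type} [Fintype I]
    (S : PCantorIFS I) (i0 : I)
    (hi0 : supD S.h S.h' [i0] < 1)
    (hsum : Summable fun w : ↥(Iinf i0) =>
      Metric.diam (wMap S.h (w : List I) '' Icc (0:ℝ) 1) ^ S.αh) :
    ∃ C : ℝ, 1 < C ∧ ∀ w ∈ IinfStar i0, ∀ x ∈ Icc (0:ℝ) 1, ∀ y ∈ Icc (0:ℝ) 1,
      |wDeriv S.h S.h' w x| ≤ C * |wDeriv S.h S.h' w y| := by
  obtain ⟨K, hK0, hK⟩ := S.exists_letter_distortion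
  obtain ⟨B, hB0, hB⟩ := S.exists_suffixSum_le_of_mem_Iinf hsum
  have hr0 : 0 ≤ supD S.h S.h' [i0] ^ S.αh := Real.rpow_nonneg (S.supD_nonneg _) _
  have hr1 : supD S.h S.h' [i0] ^ S.αh < 1 :=
    Real.rpow_lt_one (S.supD_nonneg _) hi0 S.αh_pos
  refine ⟨Real.exp (K * (B * (1 - supD S.h S.h' [i0] ^ S.αh)⁻¹) + 1), ?_, ?_⟩
  · have : 0 ≤ (1 - supD S.h S.h' [i0] ^ S.αh)⁻¹ := inv_nonneg.2 (sub_nonneg.2 hr1.le)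
    exact Real.one_lt_exp_iff.2 (by positivity)
  · rintro _ ⟨L, hL, rfl⟩ x hx y hy
    refine (S.abs_wDeriv_le_exp_suffixSum hK _ hx hy).trans ?_
    have hgeom : ∑ k ∈ Finset.range L.length, (supD S.h S.h' [i0] ^ S.αh) ^ k ≤
        (1 - supD S.h S.h' [i0] ^ S.αh)⁻¹ := by
      rw [← tsum_geometric_of_lt_one hr0 hr1]
      exact (summable_geometric_of_lt_one hr0 hr1).sum_le_tsum _ fun k _ => pow_nonneg hr0 k
    have hle := (S.suffixSum_flatten_le hB0 hB L hL hx hy).trans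
      (mul_le_mul_of_nonneg_left hgeom hB0)
    exact mul_le_mul_of_nonneg_right (Real.exp_le_exp.2
      ((mul_le_mul_of_nonneg_left hle hK0).trans (le_add_of_nonneg_right zero_le_one)))
      (abs_nonneg _)
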